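/- Let C > 1, n ≥ 3, and ρ ∈ [0,1]. Then for any two graphs G, G' on n vertices with G, G' ∈ H_{ρ,C}, the node distance satisfies (1/(8C))·min{ (n^{3/2} / (max{√ρ, √(log n / n)}·√(log n)))·|e(G) − e(G')| , n } ≤ d_v(G,G'). -/

import Mathlib

noncomputable section

/-- The number of edges of a simple graph on `n` vertices. -/
def edgeCount {n : ℕ} (G : SimpleGraph (Fin n)) : ℕ := G.edgeSet.ncard

/-- The edge density `e(G)` of a graph on `n` vertices. -/
def eDens {n : ℕ} (G : SimpleGraph (Fin n)) : ℝ := (edgeCount G : ℝ) / (n.choose 2 : ℝ)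

/-- `E_G(S, Sᶜ)`: the number of edges of `G` between `S` and its complement. -/
def crossEdges {n : ℕ} (G : SimpleGraph (Fin n)) (S : Finset (Fin n)) : ℕ :=
  Set.ncard {p : Fin n × Fin n | p.1 ∈ S ∧ p.2 ∉ S ∧ G.Adj p.1 p.2}

/-- `E_G(S)`: the number of edges of `G` with both endpoints in `S`. -/
def insideEdges {n : ℕ} (G : SimpleGraph (Fin n)) (S : Finset (Fin n)) : ℕ :=
  Set.ncard {e ∈ G.edgeSet | ∀ v ∈ e, v ∈ S}

/-- The `S`-homogeneity condition at level `t`. -/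
def HomogCond {n : ℕ} (ρ C t : ℝ) (G : SimpleGraph (Fin n)) (S : Finset (Fin n)) : Prop :=
  |((crossEdges G S : ℝ) + (insideEdges G S : ℝ))
      - t * ((S.card : ℝ) * ((n : ℝ) - (S.card : ℝ)) + (S.card.choose 2 : ℝ))|
    ≤ C * max (Real.sqrt ρ) (Real.sqrt (Real.log n / n)) * (S.card : ℝ)
        * Real.sqrt ((n : ℝ) * Real.log n)

/-- The homogeneity set `H_{ρ,C}`: graphs of edge density at most `ρ` satisfying the
`S`-homogeneity condition at level `e(G)` for every nonempty `S`. -/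
def homogSet (n : ℕ) (ρ C : ℝ) : Set (SimpleGraph (Fin n)) :=
  {G | eDens G ≤ ρ ∧ ∀ S : Finset (Fin n), S.Nonempty → HomogCond ρ C (eDens G) G S}



/-- `G'` is obtained from `G` by rewiring a single vertex. -/
def Rewire {n : ℕ} (G G' : SimpleGraph (Fin n)) : Prop :=
  ∃ v : Fin n, ∀ a b : Fin n, a ≠ v → b ≠ v → (G.Adj a b ↔ G'.Adj a b)

/-- The node (rewiring) distance between two graphs on `n` vertices. -/
def nodeDist {n : ℕ} (G G' : SimpleGraph (Fin n)) : ℕ :=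
  sInf {m : ℕ | ∃ f : ℕ → SimpleGraph (Fin n),
    f 0 = G ∧ f m = G' ∧ ∀ i < m, Rewire (f i) (f (i + 1))}

theorem edge_split {n : ℕ} (G : SimpleGraph (Fin n)) (S : Finset (Fin n)) :
    edgeCount G = crossEdges G S + insideEdges G S
      + Set.ncard {e ∈ G.edgeSet | ∀ v ∈ e, v ∉ S} := by
  classical
  have hc : crossEdges G S
      = Set.ncard {e ∈ G.edgeSet | (∃ v ∈ e, v ∈ S) ∧ (∃ v ∈ e, v ∉ S)} := by
    unfold crossEdges
    refine Set.ncard_congr (fun p _ => s(p.1, p.2)) ?_ ?_ ?_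
    · rintro ⟨a, b⟩ ⟨h1, h2, h3⟩
      exact ⟨h3, ⟨a, by simp, h1⟩, ⟨b, by simp, h2⟩⟩
    · rintro ⟨a, b⟩ ⟨c, d⟩ ⟨h1, h2, h3⟩ ⟨h4, h5, h6⟩ h
      simp only [Sym2.eq_iff] at h
      rcases h with ⟨rfl, rfl⟩ | ⟨rfl, rfl⟩
      · rfl
      · exact absurd h1 h5
    · intro e
      induction e using Sym2.ind with
      | _ a b =>
        rintro ⟨h, h1, h2⟩
        simp only [Sym2.mem_iff, exists_eq_or_imp, exists_eq_left] at h1 h2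
        have h' : G.Adj a b := h
        by_cases ha : a ∈ S
        · have hb : b ∉ S := by tauto
          exact ⟨(a, b), ⟨ha, hb, h'⟩, rfl⟩
        · have hb : b ∈ S := by tauto
          exact ⟨(b, a), ⟨hb, ha, h'.symm⟩, Sym2.eq_swap⟩
  rw [hc]
  unfold insideEdges edgeCount
  rw [← Set.ncard_union_eq, ← Set.ncard_union_eq]
  · congr 1
    ext e
    simp only [Set.mem_union, Set.mem_ofPred_eq]
    by_cases h1 : ∃ v ∈ e, v ∈ S
    · by_cases h2 : ∃ v ∈ e, v ∉ S
      · exact ⟨fun h => Or.inl (Or.inl ⟨h, h1, h2⟩), by rintro ((h | h) | h) <;> exact h.1⟩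
      · have : ∀ v ∈ e, v ∈ S := by simpa using h2
        tauto
    · have : ∀ v ∈ e, v ∉ S := by simpa using h1
      tauto
  · rw [Set.disjoint_left]
    rintro e (⟨_, ⟨v, hv, hvS⟩, _⟩ | ⟨_, h⟩) ⟨_, h'⟩
    · exact h' v hv hvS
    · induction e using Sym2.ind with
      | _ a b => exact h' a (by simp) (h a (by simp))
  · rw [Set.disjoint_left]
    rintro e ⟨_, _, ⟨v, hv, hvS⟩⟩ ⟨_, h'⟩
    exact hvS (h' v hv)

theorem nodeDist_set_nonempty {n : ℕ} (G G' : SimpleGraph (Fin n)) :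
    {m : ℕ | ∃ f : ℕ → SimpleGraph (Fin n),
      f 0 = G ∧ f m = G' ∧ ∀ i < m, Rewire (f i) (f (i + 1))}.Nonempty := by
  refine ⟨n, fun i =>
    { Adj := fun a b => ((a.val < i ∨ b.val < i) ∧ G'.Adj a b) ∨
        ((¬ (a.val < i ∨ b.val < i)) ∧ G.Adj a b)
      symm := ⟨fun a b h => by
        rw [G'.adj_comm, G.adj_comm, or_comm (a := b.val < i)]; exact h⟩
      loopless := ⟨fun a h => by simp at h⟩ }, ?_, ?_, ?_⟩
  · ext a b; simp
  · ext a b; simp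
  · intro i hi
    refine ⟨⟨i, hi⟩, fun a b ha hb => ?_⟩
    have ha' : a.val ≠ i := fun h => ha (Fin.ext h)
    have hb' : b.val ≠ i := fun h => hb (Fin.ext h)
    have h1 : a.val < i + 1 ↔ a.val < i := by omega
    have h2 : b.val < i + 1 ↔ b.val < i := by omega
    simp only [h1, h2]

theorem exists_rewired_set {n : ℕ} (f : ℕ → SimpleGraph (Fin n)) (m : ℕ)
    (h : ∀ i < m, Rewire (f i) (f (i + 1))) :
    ∃ S : Finset (Fin n), S.card ≤ m ∧
      ∀ a b, a ∉ S → b ∉ S → ((f 0).Adj a b ↔ (f m).Adj a b) := by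
  classical
  induction m with
  | zero => exact ⟨∅, by simp, fun a b _ _ => Iff.rfl⟩
  | succ k ih =>
    obtain ⟨S, hS, hSa⟩ := ih (fun i hi => h i (by omega))
    obtain ⟨v, hv⟩ := h k (by omega)
    refine ⟨insert v S, (Finset.card_insert_le _ _).trans (by omega), fun a b ha hb => ?_⟩
    simp only [Finset.mem_insert, not_or] at ha hb
    exact (hSa a b ha.2 hb.2).trans (hv a b ha.1 hb.1)

/-- For `C > 1` and graphs `G, G'` in the homogeneity set `H_{ρ,C}`,
`(1/(8C))·min{ (n^{3/2}/(max{√ρ, √(log n / n)}·√(log n)))·|e(G) − e(G')| , n } ≤ d_v(G,G')`. -/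
theorem homog_nodeDist_lower_bound (C : ℝ) (hC : 1 < C) (n : ℕ) (hn : 3 ≤ n)
    (ρ : ℝ) (hρ : ρ ∈ Set.Icc (0 : ℝ) 1)
    (G G' : SimpleGraph (Fin n)) (hG : G ∈ homogSet n ρ C) (hG' : G' ∈ homogSet n ρ C) :
    (1 / (8 * C)) * min
        ((n : ℝ) ^ ((3 : ℝ) / 2)
            / (max (Real.sqrt ρ) (Real.sqrt (Real.log n / n)) * Real.sqrt (Real.log n))
          * |eDens G - eDens G'|)
        (n : ℝ)
      ≤ (nodeDist G G' : ℝ) := by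
  have hCpos : 0 < C := by linarith
  have hn3 : (3 : ℝ) ≤ n := by exact_mod_cast hn
  have hnpos : (0 : ℝ) < n := by linarith
  have hlog : 0 < Real.log n := Real.log_pos (by linarith)
  set M := max (Real.sqrt ρ) (Real.sqrt (Real.log n / n)) with hM
  have hMpos : 0 < M := lt_max_of_lt_right (Real.sqrt_pos.mpr (div_pos hlog hnpos))
  set L := Real.sqrt (Real.log n) with hL
  have hLpos : 0 < L := Real.sqrt_pos.mpr hlog
  set q := Real.sqrt n with hq
  have hqpos : 0 < q := Real.sqrt_pos.mpr hnpos
  have hqq : q * q = n := Real.mul_self_sqrt hnpos.le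
  have hsq : Real.sqrt ((n : ℝ) * Real.log n) = q * L := Real.sqrt_mul hnpos.le _
  have hpow : (n : ℝ) ^ ((3 : ℝ) / 2) = n * q := by
    rw [show (3 : ℝ) / 2 = 1 + 1 / 2 by norm_num, Real.rpow_add hnpos, Real.rpow_one,
      ← Real.sqrt_eq_rpow]
  obtain ⟨f, hf0, hfm, hf⟩ := Nat.sInf_mem (nodeDist_set_nonempty G G')
  obtain ⟨S, hS, hSa⟩ := exists_rewired_set f _ hf
  rw [hf0, hfm] at hSa
  change S.card ≤ nodeDist G G' at hS
  have hSR : (S.card : ℝ) ≤ nodeDist G G' := by exact_mod_cast hS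
  refine le_trans ?_ hSR
  rcases S.eq_empty_or_nonempty with hE | hne
  · have : G = G' := by
      ext a b
      exact hSa a b (by simp [hE]) (by simp [hE])
    subst this
    simp [hE]
  have hs1 : (1 : ℝ) ≤ S.card := by exact_mod_cast hne.card_pos
  rw [one_div, inv_mul_le_iff₀ (by positivity)]
  by_cases hbig : (n : ℝ) ≤ 8 * C * S.card
  · exact (min_le_right _ _).trans hbig
  push Not at hbig
  refine (min_le_left _ _).trans ?_
  have hA := hG.2 S hne
  have hA' := hG'.2 S hne
  unfold HomogCond at hA hA'
  rw [← hM, hsq] at hA hA'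
  have hout : Set.ncard {e ∈ G.edgeSet | ∀ v ∈ e, v ∉ S}
      = Set.ncard {e ∈ G'.edgeSet | ∀ v ∈ e, v ∉ S} := by
    congr 1
    ext e
    induction e using Sym2.ind with
    | _ a b =>
      simp only [Set.mem_ofPred_eq, Sym2.mem_iff, forall_eq_or_imp, forall_eq,
        SimpleGraph.mem_edgeSet]
      constructor
      · rintro ⟨h, ha, hb⟩
        exact ⟨(hSa a b ha hb).1 h, ha, hb⟩
      · rintro ⟨h, ha, hb⟩
        exact ⟨(hSa a b ha hb).2 h, ha, hb⟩
  have hE1 := congrArg (Nat.cast (R := ℝ)) (edge_split G S)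
  have hE2 := congrArg (Nat.cast (R := ℝ)) (edge_split G' S)
  rw [← hout] at hE2
  push_cast at hE1 hE2
  have hNpos : (0 : ℝ) < (n.choose 2 : ℝ) := by
    exact_mod_cast Nat.choose_pos (by omega)
  have hD1 : (edgeCount G : ℝ) = eDens G * (n.choose 2 : ℝ) := by
    unfold eDens; field_simp
  have hD2 : (edgeCount G' : ℝ) = eDens G' * (n.choose 2 : ℝ) := by
    unfold eDens; field_simp
  rw [hD1] at hE1
  rw [hD2] at hE2
  rw [Nat.cast_choose_two] at hE1 hE2 hA hA'
  generalize (S.card : ℝ) = s at *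
  generalize eDens G = x at *
  generalize eDens G' = y at *
  generalize (crossEdges G S : ℝ) = c1 at *
  generalize (insideEdges G S : ℝ) = i1 at *
  generalize (crossEdges G' S : ℝ) = c2 at *
  generalize (insideEdges G' S : ℝ) = i2 at *
  generalize (Set.ncard {e ∈ G.edgeSet | ∀ v ∈ e, v ∉ S} : ℝ) = o at *
  have h8 : 8 * s ≤ n := by nlinarith
  have hK : (n : ℝ) * n / 4 ≤ (n - s) * (n - s - 1) / 2 := by nlinarith
  have hkey : |x - y| * ((n - s) * (n - s - 1) / 2) ≤ 2 * (C * M * s * (q * L)) := by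
    have hKn : (0 : ℝ) ≤ (n - s) * (n - s - 1) / 2 := le_trans (by positivity) hK
    rw [← abs_of_nonneg hKn, ← abs_mul]
    rw [abs_le] at hA hA' ⊢
    constructor <;> linarith [hA.1, hA.2, hA'.1, hA'.2]
  have h2 : |x - y| * (n * n / 4) ≤ 2 * (C * M * s * (q * L)) :=
    (mul_le_mul_of_nonneg_left hK (abs_nonneg _)).trans hkey
  rw [hpow, div_mul_eq_mul_div, div_le_iff₀ (by positivity)]
  refine le_of_mul_le_mul_right ?_ hqpos
  calc n * q * |x - y| * q = 4 * (|x - y| * (n * (q * q) / 4)) := by ring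
    _ = 4 * (|x - y| * (n * n / 4)) := by rw [hqq]
    _ ≤ 4 * (2 * (C * M * s * (q * L))) := by linarith
    _ = 8 * C * s * (M * L) * q := by ring

end
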